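/- Let k be a positive integer and let M, N be nonnegative integers. Then for every real number x, sin(x) · ∑_{l ∈ ℤ} C(M+N, M−kl) · C(M+N, N−kl) · l · sin(l·x) ≥ 0. Equivalently, ∑_{l} C(M+N, M−kl) C(M+N, N−kl) · l·sin(lx)/sin(x) ≥ 0 wherever sin(x) ≠ 0. -/

import Mathlib

/-- Binomial coefficient `C(n, b)` with integer lower index, zero unless `0 ≤ b ≤ n`. -/
def zchoose (n : ℕ) (b : ℤ) : ℕ := if 0 ≤ b then n.choose b.toNat else 0

open Finset in
/-- The divided difference of `t ↦ t ^ N` at distinct nonnegative nodes is nonnegative. -/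
theorem sum_pow_div_prod_sub_nonneg {ι : Type*} [DecidableEq ι] (v : ι → ℝ) (N : ℕ)
    (s : Finset ι) (hv : Set.InjOn v s) (h0 : ∀ i ∈ s, 0 ≤ v i) :
    0 ≤ ∑ m ∈ s, v m ^ N / ∏ i ∈ s.erase m, (v m - v i) := by
  have key : ∀ (s : Finset ι), Set.InjOn v s → ∀ a ∈ s, ∀ N : ℕ,
      ∑ m ∈ s, v m ^ (N + 1) / ∏ i ∈ s.erase m, (v m - v i) =
        v a * ∑ m ∈ s, v m ^ N / ∏ i ∈ s.erase m, (v m - v i) +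
        ∑ m ∈ s.erase a, v m ^ N / ∏ i ∈ (s.erase a).erase m, (v m - v i) := by
    intro s hv a ha N
    rw [← add_sum_erase s _ ha, ← add_sum_erase s _ ha, mul_add, mul_sum, add_assoc,
      ← sum_add_distrib]
    congr 1
    · ring
    refine sum_congr rfl fun m hm => ?_
    obtain ⟨hma, hms⟩ := mem_erase.1 hm
    have h1 : (∏ i ∈ s.erase m, (v m - v i)) =
        (v m - v a) * ∏ i ∈ (s.erase a).erase m, (v m - v i) := by
      rw [erase_right_comm, mul_prod_erase _ (fun i => v m - v i)
        (mem_erase.2 ⟨hma.symm, ha⟩)]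
    have h2 : v m - v a ≠ 0 := sub_ne_zero.2 fun h => hma (hv hms ha h)
    have h3 : (∏ i ∈ (s.erase a).erase m, (v m - v i)) ≠ 0 :=
      prod_ne_zero_iff.2 fun i hi => sub_ne_zero.2 fun h => by
        have := hv hms (mem_of_mem_erase (mem_of_mem_erase hi)) h
        exact (mem_erase.1 hi).1 this.symm
    rw [h1]
    field_simp
    ring
  have zero : ∀ (n : ℕ) (s : Finset ι), Set.InjOn v s → s.card = n + 1 →
      ∑ m ∈ s, v m ^ 0 / ∏ i ∈ s.erase m, (v m - v i) = if n = 0 then 1 else 0 := by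
    intro n
    induction n with
    | zero =>
      intro s _ hs
      obtain ⟨a, rfl⟩ := card_eq_one.1 hs
      simp
    | succ n ih =>
      intro s hv hs
      obtain ⟨a, ha, b, hb, hab⟩ := one_lt_card.1 (show 1 < s.card by omega)
      have e (c) (hc : c ∈ s) := ih (s.erase c) (hv.mono (by simp))
        (by rw [card_erase_of_mem hc]; omega)
      have k1 := key s hv a ha 0
      have k2 := key s hv b hb 0
      rw [e a ha] at k1
      rw [e b hb] at k2
      have hne : v a - v b ≠ 0 := sub_ne_zero.2 fun h => hab (hv ha hb h)
      rw [if_neg (by omega)]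
      have : (v a - v b) * ∑ m ∈ s, v m ^ 0 / ∏ i ∈ s.erase m, (v m - v i) = 0 := by
        linear_combination k2 - k1
      exact (mul_eq_zero.1 this).resolve_left hne
  induction N generalizing s with
  | zero =>
    rcases s.eq_empty_or_nonempty with rfl | hs
    · simp
    · rw [zero (s.card - 1) s hv (by have := hs.card_pos; omega)]
      split_ifs <;> norm_num
  | succ N ih =>
    rcases s.eq_empty_or_nonempty with rfl | ⟨a, ha⟩
    · simp
    · rw [key s hv a ha N]
      exact add_nonneg (mul_nonneg (h0 a ha) (ih s hv h0))
        (ih _ (hv.mono (by simp)) fun i hi => h0 i (mem_of_mem_erase hi))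

/-- The angles `θ` with `k * θ ≡ x` modulo `2 * π`, indexed by `m < k`. -/
noncomputable def rootAngle (k : ℕ) (x : ℝ) (m : ℕ) : ℝ := (x + 2 * Real.pi * m) / k

theorem mul_rootAngle {k : ℕ} (hk : 0 < k) (x : ℝ) (m : ℕ) :
    k * rootAngle k x m = x + m * (2 * Real.pi) := by
  have : (k : ℝ) ≠ 0 := by positivity
  unfold rootAngle
  field_simp

theorem injOn_cos_rootAngle {k : ℕ} (hk : 0 < k) {x : ℝ} (hx : Real.sin x ≠ 0) :
    Set.InjOn (fun m => Real.cos (rootAngle k x m)) (Finset.range k) := by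
  intro a ha b hb hab
  have ha' : a < k := by simpa using ha
  have hb' : b < k := by simpa using hb
  have ea := mul_rootAngle hk x a
  have eb := mul_rootAngle hk x b
  have hpi := Real.pi_pos
  obtain ⟨n, h | h⟩ := Real.cos_eq_cos_iff.1 hab
  · have h1 : (2 * Real.pi) * ((b : ℝ) - a - k * n) = 0 := by
      rw [h] at eb; linear_combination ea - eb
    have h2 : (b : ℝ) - a - k * n = 0 := (mul_eq_zero.1 h1).resolve_left (by positivity)
    have h3 : (b : ℤ) - a = k * n := by exact_mod_cast sub_eq_zero.1 h2
    have h4 : (b : ℤ) - a = 0 := by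
      refine Int.eq_zero_of_abs_lt_dvd (Dvd.intro _ h3.symm) ?_
      rw [abs_lt]; omega
    omega
  · refine absurd (Real.sin_eq_zero_iff.2 ⟨k * n - a - b, ?_⟩) hx
    rw [h] at eb
    push_cast
    linear_combination (eb + ea) / 2

open Polynomial in
theorem sin_rootAngle_mul_prod {k : ℕ} (hk : 0 < k) {x : ℝ} (hx : Real.sin x ≠ 0) {m : ℕ}
    (hm : m ∈ Finset.range k) :
    Real.sin (rootAngle k x m) * (2 ^ (k - 1) * ∏ i ∈ (Finset.range k).erase m,
      (Real.cos (rootAngle k x m) - Real.cos (rootAngle k x i))) = k * Real.sin x := by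
  set v : ℕ → ℝ := fun m => Real.cos (rootAngle k x m) with hv
  have hinj := injOn_cos_rootAngle hk hx
  have hT : Chebyshev.T ℝ k = C ((2 : ℝ) ^ (k - 1)) * Lagrange.nodal (Finset.range k) v
      + C (Real.cos x) := by
    refine eq_of_degree_sub_lt_of_eval_index_eq (s := Finset.range k) (v := v) hinj ?_ ?_
    · rw [← sub_sub]
      have h2 : (2 : ℝ) ^ (k - 1) ≠ 0 := by positivity
      have hdT : (Chebyshev.T ℝ k).degree = k := by simp
      have hd : (C ((2 : ℝ) ^ (k - 1)) * Lagrange.nodal (Finset.range k) v).degree = k := by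
        rw [degree_C_mul h2, Lagrange.degree_nodal, Finset.card_range]
      rw [Finset.card_range]
      refine lt_of_le_of_lt (degree_sub_le _ _) (max_lt ?_ ?_)
      · rw [← hdT]
        refine degree_sub_lt_left (by rw [hdT, hd]) ?_ ?_
        · intro h; rw [h] at hdT; simp at hdT
        · rw [leadingCoeff_mul, leadingCoeff_C, Lagrange.nodal_monic.leadingCoeff, mul_one,
            Chebyshev.leadingCoeff_T]
          simp
      · exact degree_C_le.trans_lt (by exact_mod_cast hk)
    · intro i hi
      have : ((k : ℤ) : ℝ) = k := by simp
      rw [eval_add, eval_mul, eval_C, eval_C, Lagrange.eval_nodal_at_node hi, hv,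
        Chebyshev.T_real_cos, this, mul_rootAngle hk, Real.cos_add_nat_mul_two_pi]
      ring
  have hder := congrArg (fun p => eval (v m) (derivative p)) hT
  simp only [Chebyshev.T_derivative_eq_U, derivative_add, derivative_C_mul, derivative_C,
    add_zero, eval_mul, eval_C, Lagrange.eval_nodal_derivative_eval_node_eq hm,
    Lagrange.eval_nodal] at hder
  rw [← hder]
  have hU := Chebyshev.U_real_cos (rootAngle k x m) (k - 1)
  have : (((k : ℤ) - 1 : ℤ) : ℝ) + 1 = k := by push_cast; ring
  rw [this, mul_rootAngle hk, Real.sin_add_nat_mul_two_pi] at hU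
  simp only [hv, Int.cast_natCast, eval_natCast]
  linear_combination (k : ℝ) * hU

theorem sin_mul_sum_rootAngle_nonneg {k : ℕ} (hk : 0 < k) (x : ℝ) (N : ℕ) :
    0 ≤ Real.sin x * ∑ m ∈ Finset.range k,
      (1 + Real.cos (rootAngle k x m)) ^ N * Real.sin (rootAngle k x m) := by
  by_cases hx : Real.sin x = 0
  · simp [hx]
  have hD := sum_pow_div_prod_sub_nonneg (fun m => 1 + Real.cos (rootAngle k x m)) N
    (Finset.range k) (fun a ha b hb h => injOn_cos_rootAngle hk hx ha hb (by simpa using h))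
    (fun i _ => by linarith [Real.neg_one_le_cos (rootAngle k x i)])
  have : Real.sin x * ∑ m ∈ Finset.range k,
      (1 + Real.cos (rootAngle k x m)) ^ N * Real.sin (rootAngle k x m) =
      k * Real.sin x ^ 2 / 2 ^ (k - 1) * ∑ m ∈ Finset.range k,
        (1 + Real.cos (rootAngle k x m)) ^ N / ∏ i ∈ (Finset.range k).erase m,
          ((1 + Real.cos (rootAngle k x m)) - (1 + Real.cos (rootAngle k x i))) := by
    rw [Finset.mul_sum, Finset.mul_sum]
    refine Finset.sum_congr rfl fun m hm => ?_
    have h := sin_rootAngle_mul_prod hk hx hm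
    simp only [add_sub_add_left_eq_sub]
    have hP : (∏ i ∈ (Finset.range k).erase m,
        (Real.cos (rootAngle k x m) - Real.cos (rootAngle k x i))) ≠ 0 := by
      intro h0
      rw [h0] at h
      have : (k : ℝ) * Real.sin x ≠ 0 := mul_ne_zero (by positivity) hx
      rw [mul_zero, mul_zero] at h
      exact this h.symm
    field_simp
    linear_combination (1 + Real.cos (rootAngle k x m)) ^ N * h
  rw [this]
  exact mul_nonneg (by positivity) hD

theorem sum_sin_int_mul_rootAngle_of_not_dvd {k : ℕ} (hk : 0 < k) (x : ℝ) {d : ℤ}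
    (hd : ¬ (k : ℤ) ∣ d) :
    ∑ m ∈ Finset.range k, Real.sin (d * rootAngle k x m) = 0 := by
  have hk' : (k : ℂ) ≠ 0 := by exact_mod_cast hk.ne'
  have hp := Complex.isPrimitiveRoot_exp k hk.ne'
  set ζ := Complex.exp (2 * Real.pi * Complex.I / k)
  have h1 : ζ ^ d ≠ 1 := fun h => hd ((hp.zpow_eq_one_iff_dvd d).1 h)
  have h2 : (ζ ^ d) ^ k = 1 := by
    rw [← zpow_natCast, ← zpow_mul, mul_comm, zpow_mul, zpow_natCast, hp.pow_eq_one, one_zpow]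
  have h3 : ∑ m ∈ Finset.range k, (ζ ^ d) ^ m = 0 := by
    have := mul_neg_geom_sum (ζ ^ d) k
    rw [h2, sub_self] at this
    exact (mul_eq_zero.1 this).resolve_left (sub_ne_zero.2 h1.symm)
  have h4 : ∑ m ∈ Finset.range k, Complex.exp ((d * rootAngle k x m : ℝ) * Complex.I) = 0 := by
    rw [← mul_zero (Complex.exp (d * x / k * Complex.I)), ← h3, Finset.mul_sum]
    refine Finset.sum_congr rfl fun m _ => ?_
    rw [← Complex.exp_int_mul, ← Complex.exp_nat_mul, ← Complex.exp_add]
    congr 1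
    unfold rootAngle
    push_cast
    field_simp
  have h5 := congrArg Complex.im h4
  simpa only [Complex.im_sum, Complex.exp_ofReal_mul_I_im, Complex.zero_im] using h5

theorem sum_sin_mul_rootAngle {k : ℕ} (hk : 0 < k) (x : ℝ) (l : ℤ) :
    ∑ m ∈ Finset.range k, Real.sin ((k * l : ℤ) * rootAngle k x m) = k * Real.sin (l * x) := by
  have (m : ℕ) : Real.sin ((k * l : ℤ) * rootAngle k x m) = Real.sin (l * x) := by
    have : ((k * l : ℤ) : ℝ) * rootAngle k x m = l * x + (l * m : ℤ) * (2 * Real.pi) := by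
      push_cast
      linear_combination (l : ℝ) * mul_rootAngle hk x m
    rw [this, Real.sin_add_int_mul_two_pi]
  simp only [this, Finset.sum_const, Finset.card_range, nsmul_eq_mul]

theorem two_add_two_mul_cos_pow (j : ℕ) (θ : ℝ) :
    (2 + 2 * Real.cos θ) ^ j =
      ∑ d ∈ Finset.range (2 * j + 1), ((2 * j).choose d : ℝ) * Real.cos (((d : ℝ) - j) * θ) := by
  have h : (2 + 2 * Real.cos θ) = (2 * Real.cos (θ / 2)) ^ 2 := by
    have := Real.cos_sq (θ / 2)
    rw [mul_div_cancel₀ θ two_ne_zero] at this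
    rw [mul_pow, this]; ring
  have hc : (((2 + 2 * Real.cos θ) ^ j : ℝ) : ℂ) = ∑ d ∈ Finset.range (2 * j + 1),
      ((2 * j).choose d : ℝ) * Complex.exp ((((d : ℝ) - j) * θ : ℝ) * Complex.I) := by
    rw [h, ← pow_mul]
    push_cast
    rw [Complex.two_cos, add_pow]
    refine Finset.sum_congr rfl fun d hd => ?_
    have hd' : d ≤ 2 * j := by simpa [Nat.lt_succ_iff] using hd
    rw [← Complex.exp_nat_mul, ← Complex.exp_nat_mul, ← Complex.exp_add, mul_comm]
    congr 2
    push_cast [Nat.cast_sub hd']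
    ring
  have hr := congrArg Complex.re hc
  simpa only [Complex.ofReal_re, Complex.re_sum, Complex.re_ofReal_mul,
    Complex.exp_ofReal_mul_I_re] using hr

theorem two_add_two_mul_cos_pow_mul_sin (j : ℕ) (θ : ℝ) :
    2 * j * (2 + 2 * Real.cos θ) ^ (j - 1) * Real.sin θ =
      ∑ d ∈ Finset.range (2 * j + 1),
        ((2 * j).choose d : ℝ) * (((d : ℝ) - j) * Real.sin (((d : ℝ) - j) * θ)) := by
  have h1 : HasDerivAt (fun θ => (2 + 2 * Real.cos θ) ^ j)
      (j * (2 + 2 * Real.cos θ) ^ (j - 1) * (2 * -Real.sin θ)) θ :=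
    (((Real.hasDerivAt_cos θ).const_mul 2).const_add 2).pow j
  have h2 : HasDerivAt (fun θ => ∑ d ∈ Finset.range (2 * j + 1),
      ((2 * j).choose d : ℝ) * Real.cos (((d : ℝ) - j) * θ))
      (∑ d ∈ Finset.range (2 * j + 1),
        ((2 * j).choose d : ℝ) * (-Real.sin (((d : ℝ) - j) * θ) * (((d : ℝ) - j) * 1))) θ :=
    HasDerivAt.fun_sum fun d _ =>
      (((hasDerivAt_id θ).const_mul ((d : ℝ) - j)).cos).const_mul _
  have h3 := h1.unique ((funext (two_add_two_mul_cos_pow j)) ▸ h2)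
  have h4 := congrArg Neg.neg h3
  rw [← Finset.sum_neg_distrib] at h4
  calc _ = -(j * (2 + 2 * Real.cos θ) ^ (j - 1) * (2 * -Real.sin θ)) := by ring
    _ = _ := h4
    _ = _ := Finset.sum_congr rfl fun d _ => by ring

theorem zchoose_of_neg {n : ℕ} {b : ℤ} (h : b < 0) : zchoose n b = 0 := by
  simp [zchoose, h]

theorem zchoose_natCast (n b : ℕ) : zchoose n b = n.choose b := by
  simp [zchoose]

theorem zchoose_of_lt {n : ℕ} {b : ℤ} (h : (n : ℤ) < b) : zchoose n b = 0 := by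
  lift b to ℕ using by omega
  rw [zchoose_natCast, Nat.choose_eq_zero_of_lt (by omega)]

theorem zchoose_symm (n : ℕ) (b : ℤ) : zchoose n (n - b) = zchoose n b := by
  rcases lt_or_ge b 0 with h | h
  · rw [zchoose_of_neg h, zchoose_of_lt (by omega)]
  rcases lt_or_ge (n : ℤ) b with h' | h'
  · rw [zchoose_of_lt h', zchoose_of_neg (by omega)]
  lift b to ℕ using h
  have hb : b ≤ n := by omega
  rw [← Nat.cast_sub hb, zchoose_natCast, zchoose_natCast, Nat.choose_symm hb]

/-- The case of a central binomial row: the inequality for `∑ C(2j, j + kl) l sin (lx)`. -/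
theorem sin_mul_sum_zchoose_two_mul_nonneg {k : ℕ} (hk : 0 < k) (j : ℕ) {L : ℤ}
    (hL : (j : ℤ) ≤ L) (x : ℝ) :
    0 ≤ Real.sin x * ∑ l ∈ Finset.Icc (-L) L,
      (zchoose (2 * j) (j + k * l) : ℝ) * ((l : ℝ) * Real.sin (l * x)) := by
  have hk' : (0 : ℝ) < k := by exact_mod_cast hk
  set f : ℕ → ℝ := fun d => ((2 * j).choose d : ℝ) *
    (((d : ℝ) - j) * ∑ m ∈ Finset.range k, Real.sin (((d : ℝ) - j) * rootAngle k x m)) with hf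
  have hcast (d : ℕ) : (d : ℝ) - j = ((d - j : ℤ) : ℝ) := by push_cast; ring
  have key : ∑ l ∈ Finset.Icc (-L) L,
      (k : ℝ) ^ 2 * ((zchoose (2 * j) (j + k * l) : ℝ) * ((l : ℝ) * Real.sin (l * x))) =
      ∑ d ∈ Finset.range (2 * j + 1), f d := by
    have range_of_ne {l : ℤ} (h : (k : ℝ) ^ 2 *
        ((zchoose (2 * j) (j + k * l) : ℝ) * ((l : ℝ) * Real.sin (l * x))) ≠ 0) :
        0 ≤ j + k * l ∧ j + k * l ≤ 2 * j := by
      constructor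
      · by_contra! h'
        exact h (by simp [zchoose_of_neg h'])
      · by_contra! h'
        exact h (by rw [zchoose_of_lt (by push_cast; exact h')]; simp)
    have val (l : ℤ) (d : ℕ) (hd : (d : ℤ) = j + k * l) : (k : ℝ) ^ 2 *
        ((zchoose (2 * j) (j + k * l) : ℝ) * ((l : ℝ) * Real.sin (l * x))) = f d := by
      have h1 : (d : ℤ) - j = k * l := by omega
      simp only [hf, hcast, h1, sum_sin_mul_rootAngle hk]
      rw [← hd, zchoose_natCast]
      push_cast
      ring
    refine Finset.sum_bij_ne_zero (fun l _ _ => (j + k * l).toNat) ?_ ?_ ?_ ?_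
    · intro l _ h
      have := range_of_ne h
      simp only [Finset.mem_range]
      omega
    · intro a _ ha b _ hb hab
      have h1 := range_of_ne ha
      have h2 := range_of_ne hb
      have : (k : ℤ) * a = k * b := by omega
      exact mul_left_cancel₀ (by omega) this
    · intro d hd h
      have hdvd : (k : ℤ) ∣ d - j := by
        by_contra hn
        refine h ?_
        simp only [hf, hcast, sum_sin_int_mul_rootAngle_of_not_dvd hk x hn, mul_zero]
      obtain ⟨l, hl⟩ := hdvd
      have hd' := Finset.mem_range.1 hd
      have hk1 : (1 : ℤ) ≤ k := by omega
      refine ⟨l, Finset.mem_Icc.2 ⟨by nlinarith, by nlinarith⟩, ?_, by omega⟩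
      rw [val l d (by omega)]
      exact h
    · intro l _ h
      have := range_of_ne h
      exact val l _ (by omega)
  have key2 : ∑ d ∈ Finset.range (2 * j + 1), f d =
      2 * j * 2 ^ (j - 1) * ∑ m ∈ Finset.range k,
        (1 + Real.cos (rootAngle k x m)) ^ (j - 1) * Real.sin (rootAngle k x m) := by
    simp only [hf, Finset.mul_sum]
    rw [Finset.sum_comm]
    refine Finset.sum_congr rfl fun m _ => ?_
    rw [← two_add_two_mul_cos_pow_mul_sin,
      show 2 + 2 * Real.cos (rootAngle k x m) = 2 * (1 + Real.cos (rootAngle k x m)) by ring,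
      mul_pow]
    ring
  rw [← Finset.mul_sum, key2] at key
  have hnn := sin_mul_sum_rootAngle_nonneg hk x (j - 1)
  refine nonneg_of_mul_nonneg_right (a := (k : ℝ) ^ 2) ?_ (by positivity)
  rw [mul_left_comm, key, mul_left_comm]
  exact mul_nonneg (by positivity) hnn

theorem choose_mul_choose_mul_choose (n a b c : ℕ) (ha : c ≤ a) (hb : c ≤ b) :
    n.choose b * (b.choose c * (n - b).choose (a - c)) =
      n.choose (a + b - 2 * c) * (n - (a + b - 2 * c)).choose c *
        (a + b - 2 * c).choose (b - c) := by
  obtain ⟨p, rfl⟩ := Nat.exists_eq_add_of_le ha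
  obtain ⟨q, rfl⟩ := Nat.exists_eq_add_of_le hb
  rw [show c + p + (c + q) - 2 * c = q + p by omega, show c + p - c = p by omega,
    show c + q - c = q by omega]
  rcases lt_or_ge n (c + q + p) with h | h
  · have h1 : n.choose (c + q) * (n - (c + q)).choose p = 0 := by
      rcases lt_or_ge n (c + q) with h' | h'
      · rw [Nat.choose_eq_zero_of_lt h', zero_mul]
      · rw [Nat.choose_eq_zero_of_lt (n := n - (c + q)) (by omega), mul_zero]
    have h2 : n.choose (q + p) * (n - (q + p)).choose c = 0 := by
      rcases lt_or_ge n (q + p) with h' | h'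
      · rw [Nat.choose_eq_zero_of_lt h', zero_mul]
      · rw [Nat.choose_eq_zero_of_lt (n := n - (q + p)) (by omega), mul_zero]
    rw [mul_left_comm, h1, h2]
    simp
  · obtain ⟨r, rfl⟩ := Nat.exists_eq_add_of_le h
    rw [show c + q + p + r - (c + q) = p + r by omega,
      show c + q + p + r - (q + p) = c + r by omega]
    have choose_left (i j : ℕ) :
        (i + j).choose i * i.factorial * j.factorial = (i + j).factorial := by
      rw [Nat.choose_symm_add, Nat.add_choose_mul_factorial_mul_factorial]
    have e1 := choose_left (c + q) (p + r)
    have e2 := choose_left c q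
    have e3 := choose_left p r
    have e4 := choose_left (q + p) (c + r)
    have e5 := choose_left c r
    have e6 := choose_left q p
    rw [← add_assoc] at e1
    rw [show q + p + (c + r) = c + q + p + r by ring] at e4
    have hpos : 0 < c.factorial * q.factorial * p.factorial * r.factorial := by positivity
    refine Nat.eq_of_mul_eq_mul_right hpos ?_
    calc _ = (c + q + p + r).choose (c + q) *
          ((c + q).choose c * c.factorial * q.factorial) *
          ((p + r).choose p * p.factorial * r.factorial) := by ring
      _ = (c + q + p + r).choose (q + p) *
          ((q + p).choose q * q.factorial * p.factorial) *
          ((c + r).choose c * c.factorial * r.factorial) := by rw [e2, e3, e5, e6, e1, e4]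
      _ = _ := by ring

theorem zchoose_sub_mul_zchoose_add (n M : ℕ) (d : ℤ) :
    zchoose n (M - d) * zchoose n (M + d) = ∑ i ∈ Finset.range (M + 1),
      n.choose (2 * i) * (n - 2 * i).choose (M - i) * zchoose (2 * i) (i + d) := by
  rcases lt_or_ge (M - d) 0 with h | h
  · rw [zchoose_of_neg h, zero_mul]
    refine (Finset.sum_eq_zero fun i hi => ?_).symm
    have := Finset.mem_range.1 hi
    rw [zchoose_of_lt (by push_cast; omega), mul_zero]
  rcases lt_or_ge (M + d) 0 with h' | h'
  · rw [zchoose_of_neg h', mul_zero]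
    refine (Finset.sum_eq_zero fun i hi => ?_).symm
    have := Finset.mem_range.1 hi
    rw [zchoose_of_neg (by omega), mul_zero]
  obtain ⟨a, ha⟩ := Int.eq_ofNat_of_zero_le h
  obtain ⟨b, hb⟩ := Int.eq_ofNat_of_zero_le h'
  rw [ha, hb, zchoose_natCast, zchoose_natCast, ← Finset.sum_range_reflect]
  have hterm (c : ℕ) (hc : c ∈ Finset.range (M + 1)) :
      n.choose (2 * (M + 1 - 1 - c)) * (n - 2 * (M + 1 - 1 - c)).choose (M - (M + 1 - 1 - c)) *
        zchoose (2 * (M + 1 - 1 - c)) ((M + 1 - 1 - c : ℕ) + d) =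
      if c ≤ a then n.choose b * (b.choose c * (n - b).choose (a - c)) else 0 := by
    have hc := Finset.mem_range.1 hc
    split_ifs with hca
    · rcases lt_or_ge b c with hcb | hcb
      · rw [zchoose_of_neg (by omega), Nat.choose_eq_zero_of_lt hcb]
        simp
      · rw [choose_mul_choose_mul_choose n a b c hca hcb,
          show 2 * (M + 1 - 1 - c) = a + b - 2 * c by omega,
          show M - (M + 1 - 1 - c) = c by omega,
          show ((M + 1 - 1 - c : ℕ) : ℤ) + d = (b - c : ℕ) by omega, zchoose_natCast]
    · rw [zchoose_of_lt (by push_cast; omega), mul_zero]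
  rw [Finset.sum_congr rfl hterm, ← Finset.sum_filter]
  rcases lt_or_ge n b with hnb | hnb
  · simp [Nat.choose_eq_zero_of_lt hnb]
  have hv := Nat.add_choose_eq b (n - b) a
  rw [Nat.add_sub_cancel' hnb, Finset.Nat.sum_antidiagonal_eq_sum_range_succ
    (fun p q => b.choose p * (n - b).choose q)] at hv
  rw [hv, mul_comm, Finset.mul_sum]
  symm
  refine Finset.sum_subset_zero_on_sdiff ?_ ?_ fun _ _ => rfl
  · intro c hc
    simp only [Finset.mem_filter, Finset.mem_range] at hc ⊢
    omega
  · intro c hc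
    simp only [Finset.mem_sdiff, Finset.mem_filter, Finset.mem_range] at hc
    rw [Nat.choose_eq_zero_of_lt (n := b) (k := c) (by omega)]
    simp

theorem stmt16 (k M N : ℕ) (hk : 0 < k) (x : ℝ) :
    0 ≤ Real.sin x *
      ∑ l ∈ Finset.Icc (-((M : ℤ) + N)) ((M : ℤ) + N),
        (zchoose (M + N) ((M : ℤ) - k * l) : ℝ) *
          (zchoose (M + N) ((N : ℤ) - k * l) : ℝ) * ((l : ℝ) * Real.sin (l * x)) := by
  have hterm (l : ℤ) : (zchoose (M + N) ((M : ℤ) - k * l) : ℝ) *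
      (zchoose (M + N) ((N : ℤ) - k * l) : ℝ) =
      ∑ i ∈ Finset.range (M + 1),
        ((M + N).choose (2 * i) * (M + N - 2 * i).choose (M - i) : ℝ) *
          zchoose (2 * i) (i + k * l) := by
    rw [← zchoose_symm (M + N) (N - k * l),
      show ((M + N : ℕ) : ℤ) - (N - k * l) = M + k * l by push_cast; ring]
    exact_mod_cast zchoose_sub_mul_zchoose_add (M + N) M (k * l)
  simp only [hterm, Finset.sum_mul]
  rw [Finset.sum_comm, Finset.mul_sum]
  refine Finset.sum_nonneg fun i hi => ?_
  have hi' := Finset.mem_range.1 hi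
  simp only [mul_assoc]
  rw [← Finset.mul_sum, ← Finset.mul_sum, mul_left_comm, mul_left_comm (Real.sin x)]
  exact mul_nonneg (by positivity) (mul_nonneg (by positivity)
    (sin_mul_sum_zchoose_two_mul_nonneg hk i (by omega) x))
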